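/- Let a8,a9,a6,a7 ∈ F_q^× with (a6,a7) not a scalar multiple of (a8,a9). Define λ on K = {0}×V by λ(t3,t5,t6,t7,t8,t9) = φ(a6·t6 + a7·t7 + a8·t8 + a9·t9). Then λ^H(x(t)) = q^3·φ(a6·t6 + a7·t7 + a8·t8 + a9·t9) if t1 = t2 = t3 = t4 = t5 = 0 and a8·t6 + a9·t7 = 0, and λ^H(x(t)) = 0 otherwise. -/

import Mathlib

open Finset
open scoped Classical

noncomputable section

/-- The additive character `φ(x) = exp(2πi·Tr(x)/p)` of `F_q`, where `Tr` is the trace to `F_p`. -/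
def phi (p : ℕ) (F : Type) [Field F] [Fintype F] [Algebra (ZMod p) F] (x : F) : ℂ :=
  Complex.exp (2 * Real.pi * Complex.I * ((Algebra.trace (ZMod p) F x).val : ℂ) / (p : ℂ))

namespace UM10

variable (F : Type) [Field F] [Fintype F]

/- `V = F_q^6` has coordinates `(t3,t5,t6,t7,t8,t9)`, indexed `0,…,5`. -/

/-- `σ1(s) : t5 ↦ t5 − s·t3, t8 ↦ t8 − s·t6, t9 ↦ t9 − s·t7`. -/
def sig1 (s : F) (v : Fin 6 → F) : Fin 6 → F :=
  ![v 0, v 1 - s * v 0, v 2, v 3, v 4 - s * v 2, v 5 - s * v 3]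

/-- `σ2(s) : t6 ↦ t6 − s·t3, t8 ↦ t8 − s·t5`. -/
def sig2 (s : F) (v : Fin 6 → F) : Fin 6 → F :=
  ![v 0, v 1, v 2 - s * v 0, v 3, v 4 - s * v 1, v 5]

/-- `σ4(s) : t7 ↦ t7 − s·t3, t9 ↦ t9 − s·t5`. -/
def sig4 (s : F) (v : Fin 6 → F) : Fin 6 → F :=
  ![v 0, v 1, v 2, v 3 - s * v 0, v 4, v 5 - s * v 1]

/-- The composite action `σ1(s1)σ2(s2)σ4(s4)` of `F_q^3` on `V`. -/
def sigma (s : Fin 3 → F) (v : Fin 6 → F) : Fin 6 → F :=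
  sig1 F (s 0) (sig2 F (s 1) (sig4 F (s 2) v))

/-- Multiplication in the semidirect product `H = F_q^3 ⋉ V`:
conjugating `(0,v)` by `(s,0)` yields `(0, σ1(s1)σ2(s2)σ4(s4)(v))`. -/
def Hmul (x y : (Fin 3 → F) × (Fin 6 → F)) : (Fin 3 → F) × (Fin 6 → F) :=
  (x.1 + y.1, sigma F y.1 x.2 + y.2)

/-- Inversion in `H`. -/
def Hinv (x : (Fin 3 → F) × (Fin 6 → F)) : (Fin 3 → F) × (Fin 6 → F) :=
  (-x.1, -(sigma F (-x.1) x.2))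

/-- Conjugation `x⁻¹ h x` in `H`. -/
def Hconj (x h : (Fin 3 → F) × (Fin 6 → F)) : (Fin 3 → F) × (Fin 6 → F) :=
  Hmul F (Hmul F (Hinv F x) h) x

/-- The element `x(t) = (0,(t3,0,…,0))·((t1,t2,t4),0)·(0,(0,t5,t6,t7,t8,t9))` of `H`,
for `t = (t1,…,t9)` (indexed `0,…,8`). -/
def xelt (t : Fin 9 → F) : (Fin 3 → F) × (Fin 6 → F) :=
  Hmul F (Hmul F ((0 : Fin 3 → F), ![t 2, 0, 0, 0, 0, 0]) (![t 0, t 1, t 3], (0 : Fin 6 → F)))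
    ((0 : Fin 3 → F), ![0, t 4, t 5, t 6, t 7, t 8])

/-- The extension by zero to `H` of a function on a subset `K` of `H`. -/
def dotExt (K : Set ((Fin 3 → F) × (Fin 6 → F))) (lam : (Fin 3 → F) × (Fin 6 → F) → ℂ)
    (h : (Fin 3 → F) × (Fin 6 → F)) : ℂ :=
  if h ∈ K then lam h else 0

/-- The induced class function `λ^H(h) = (1/|K|) ∑_{x∈H} λ̇(x⁻¹ h x)`, for `λ` defined
on a subgroup `K` of order `cardK`. -/
def ind (cardK : ℕ) (K : Set ((Fin 3 → F) × (Fin 6 → F)))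
    (lam : (Fin 3 → F) × (Fin 6 → F) → ℂ) (h : (Fin 3 → F) × (Fin 6 → F)) : ℂ :=
  (1 / (cardK : ℂ)) * ∑ x : (Fin 3 → F) × (Fin 6 → F), dotExt F K lam (Hconj F x h)

end UM10

namespace UM10

variable {F : Type} [Field F]

lemma sigma_apply (s : Fin 3 → F) (v : Fin 6 → F) :
    sigma F s v = ![v 0, v 1 - s 0 * v 0, v 2 - s 1 * v 0, v 3 - s 2 * v 0,
      v 4 - s 1 * v 1 - s 0 * (v 2 - s 1 * v 0), v 5 - s 2 * v 1 - s 0 * (v 3 - s 2 * v 0)] := by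
  simp [sigma, sig1, sig2, sig4]

lemma Hconj_fst (x h : (Fin 3 → F) × (Fin 6 → F)) : (Hconj F x h).1 = h.1 := by
  simp [Hconj, Hmul, Hinv]

lemma Hconj_snd_of_fst_eq_zero (x h : (Fin 3 → F) × (Fin 6 → F)) (hh : h.1 = 0) :
    (Hconj F x h).2 = sigma F x.1 h.2 := by
  ext i
  fin_cases i <;> simp only [Hconj, Hmul, Hinv, sigma_apply, hh, Pi.add_apply, Pi.neg_apply,
    Pi.zero_apply, Fin.zero_eta, Fin.mk_one, Fin.reduceFinMk, Matrix.cons_val] <;> ring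

lemma xelt_fst (t : Fin 9 → F) : (xelt F t).1 = ![t 0, t 1, t 3] := by
  simp [xelt, Hmul]

lemma xelt_snd (t : Fin 9 → F) (h0 : t 0 = 0) (h1 : t 1 = 0) (h3 : t 3 = 0) :
    (xelt F t).2 = ![t 2, t 4, t 5, t 6, t 7, t 8] := by
  ext i
  fin_cases i <;> simp [xelt, Hmul, sigma_apply, h0, h1, h3]

variable [Fintype F]

/-- The additive character `phi`, bundled. -/
def phiChar (p : ℕ) [Fact p.Prime] (F : Type) [Field F] [Fintype F] [Algebra (ZMod p) F] :
    AddChar F ℂ :=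
  ZMod.stdAddChar.compAddMonoidHom (Algebra.trace (ZMod p) F).toAddMonoidHom

lemma phi_eq_phiChar (p : ℕ) [Fact p.Prime] [Algebra (ZMod p) F] (x : F) :
    phi p F x = phiChar p F x := by
  simp [phi, phiChar, ZMod.stdAddChar_apply, ZMod.toCircle_apply]

lemma phiChar_isPrimitive (p : ℕ) [Fact p.Prime] [Algebra (ZMod p) F] :
    (phiChar p F).IsPrimitive := by
  apply AddChar.IsPrimitive.of_ne_one
  intro h
  obtain ⟨x, hx⟩ := Algebra.trace_surjective (ZMod p) F 1
  have h1 : phiChar p F x = 1 := by rw [h]; rfl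
  have h2 : ZMod.stdAddChar (1 : ZMod p) = ZMod.stdAddChar (0 : ZMod p) := by
    rw [AddChar.map_zero_eq_one, ← h1, ← hx]
    rfl
  exact one_ne_zero (ZMod.injective_stdAddChar h2)

lemma sum_phiChar_mul (p : ℕ) [Fact p.Prime] [Algebra (ZMod p) F] (c : F) :
    ∑ x, phiChar p F (x * c) = if c = 0 then (Fintype.card F : ℂ) else 0 := by
  rw [AddChar.sum_mulShift c (phiChar_isPrimitive p)]
  split_ifs <;> simp

lemma sum_fin_three {α M : Type*} [Fintype α] [AddCommMonoid M] (f : α → α → α → M) :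
    ∑ s : Fin 3 → α, f (s 0) (s 1) (s 2) = ∑ a, ∑ b, ∑ c, f a b c := by
  let e : (Fin 3 → α) ≃ α × α × α :=
    { toFun := fun s => (s 0, s 1, s 2)
      invFun := fun y => ![y.1, y.2.1, y.2.2]
      left_inv := fun s => by ext i; fin_cases i <;> rfl
      right_inv := fun _ => rfl }
  rw [Fintype.sum_equiv e (fun s => f (s 0) (s 1) (s 2)) (fun y => f y.1 y.2.1 y.2.2)
    (fun _ => rfl)]
  simp only [Fintype.sum_prod_type]

lemma sum_phiChar_affine (p : ℕ) [Fact p.Prime] [Algebra (ZMod p) F] (P Q R : F → F) :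
    ∑ a, ∑ b, ∑ c, phiChar p F (R a + b * P a + c * Q a) =
      ∑ a, if P a = 0 ∧ Q a = 0 then (Fintype.card F : ℂ) ^ 2 * phiChar p F (R a) else 0 := by
  refine Finset.sum_congr rfl fun a _ => ?_
  simp only [AddChar.map_add_eq_mul, ← Finset.mul_sum, ← Finset.sum_mul, sum_phiChar_mul]
  split_ifs <;> simp_all
  ring

end UM10
open UM10 in
/-- the values of the induced character `λ^H` where
`λ(t3,t5,t6,t7,t8,t9) = φ(a6·t6 + a7·t7 + a8·t8 + a9·t9)` on `K = {0} × V`. -/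
theorem stmt3 (p : ℕ) [Fact p.Prime] (F : Type) [Field F] [Fintype F] [CharP F p]
    [Algebra (ZMod p) F] (a8 a9 a6 a7 : F) (h8 : a8 ≠ 0) (h9 : a9 ≠ 0) (h6 : a6 ≠ 0)
    (h7 : a7 ≠ 0) (hm : ¬∃ d : F, a6 = d * a8 ∧ a7 = d * a9) (t : Fin 9 → F) :
    ind F ((Fintype.card F) ^ 6) {h | h.1 = 0}
        (fun h => phi p F (a6 * h.2 2 + a7 * h.2 3 + a8 * h.2 4 + a9 * h.2 5))
        (xelt F t) =
      if t 0 = 0 ∧ t 1 = 0 ∧ t 2 = 0 ∧ t 3 = 0 ∧ t 4 = 0 ∧ a8 * t 5 + a9 * t 6 = 0 then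
        (Fintype.card F : ℂ) ^ 3 * phi p F (a6 * t 5 + a7 * t 6 + a8 * t 7 + a9 * t 8)
      else 0 := by
  have hq : (Fintype.card F : ℂ) ≠ 0 := by simp
  by_cases h013 : t 0 = 0 ∧ t 1 = 0 ∧ t 3 = 0
  swap
  · have hK : ∀ x, Hconj F x (xelt F t) ∉ {h : (Fin 3 → F) × (Fin 6 → F) | h.1 = 0} := by
      intro x hx
      simp only [Set.mem_ofPred_eq, Hconj_fst, xelt_fst] at hx
      exact h013 ⟨congrFun hx 0, congrFun hx 1, congrFun hx 2⟩
    rw [if_neg (by tauto)]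
    simp [ind, dotExt, hK]
  obtain ⟨h0, h1, h3⟩ := h013
  have hx1 : (xelt F t).1 = 0 := by
    rw [xelt_fst, h0, h1, h3]
    ext i
    fin_cases i <;> rfl
  have hterm : ∀ x, dotExt F {h | h.1 = 0}
      (fun h => phi p F (a6 * h.2 2 + a7 * h.2 3 + a8 * h.2 4 + a9 * h.2 5))
      (Hconj F x (xelt F t)) =
      (fun a b c => phiChar p F
        ((a6 * t 5 + a7 * t 6 + a8 * t 7 + a9 * t 8 + a * -(a8 * t 5 + a9 * t 6)) +
          b * (a8 * (a * t 2 - t 4) - a6 * t 2) + c * (a9 * (a * t 2 - t 4) - a7 * t 2)))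
        (x.1 0) (x.1 1) (x.1 2) := by
    intro x
    have hmem : Hconj F x (xelt F t) ∈ {h : (Fin 3 → F) × (Fin 6 → F) | h.1 = 0} := by
      simp [Hconj_fst, hx1]
    rw [dotExt, if_pos hmem, Hconj_snd_of_fst_eq_zero _ _ hx1, xelt_snd t h0 h1 h3,
      phi_eq_phiChar, sigma_apply]
    simp only [Matrix.cons_val]
    congr 1
    ring
  have hcond : ∀ a, (a8 * (a * t 2 - t 4) - a6 * t 2 = 0 ∧ a9 * (a * t 2 - t 4) - a7 * t 2 = 0) ↔
      (t 2 = 0 ∧ t 4 = 0) := by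
    intro a
    constructor
    · rintro ⟨hP, hQ⟩
      have h2 : t 2 = 0 := by
        by_contra h2
        refine hm ⟨(a * t 2 - t 4) / t 2, ?_, ?_⟩ <;> field_simp
        · linear_combination -hP
        · linear_combination -hQ
      refine ⟨h2, ?_⟩
      simpa [h2, h8] using hP
    · rintro ⟨h2, h4⟩
      simp [h2, h4]
  rw [ind, Finset.sum_congr rfl fun x _ => hterm x, Fintype.sum_prod_type]
  simp only [Finset.sum_const, ← Finset.smul_sum]
  rw [sum_fin_three (fun a b c => phiChar p F
    ((a6 * t 5 + a7 * t 6 + a8 * t 7 + a9 * t 8 + a * -(a8 * t 5 + a9 * t 6)) +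
      b * (a8 * (a * t 2 - t 4) - a6 * t 2) + c * (a9 * (a * t 2 - t 4) - a7 * t 2))),
    sum_phiChar_affine]
  simp only [hcond]
  by_cases h24 : t 2 = 0 ∧ t 4 = 0
  swap
  · rw [if_neg (by tauto)]
    simp [h24]
  simp only [h24, and_self, if_true, ← Finset.mul_sum, h0, h1, h3, true_and, phi_eq_phiChar]
  rw [Finset.sum_congr rfl fun a _ => AddChar.map_add_eq_mul (phiChar p F) _ _, ← Finset.mul_sum,
    sum_phiChar_mul]
  simp only [neg_eq_zero]
  split_ifs
  · simp [hq]
    field_simp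
  · simp
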